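/- Let p be a prime, n ≥ 1, and let G be a compact subgroup of GL_n(ℚ_p) with normalized Haar probability measure μ. Then either G is virtually solvable, or G is randomly free, i.e. for every r ≥ 1 and every nontrivial word w in the free group F_r on r generators, the set X(G,w) = {(g_1,…,g_r) ∈ G^r : w(g_1,…,g_r) = 1} has measure zero with respect to the product measure μ^{⊗r}. -/

import Mathlib

open MeasureTheory

/-- `P` is the reduction of a rescaling of `X` that is integral and nonzero modulo the maximal
ideal. -/
def IsReduction {K ι : Type*} [Field K] (O : ValuationSubring K) (X : Matrix ι ι K)
    (P : Matrix ι ι (IsLocalRing.ResidueField O)) : Prop :=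
  P ≠ 0 ∧ ∃ (a : K) (Y : Matrix ι ι O), a ≠ 0 ∧ Y.map O.subtype = a • X ∧
    Y.map (IsLocalRing.residue O) = P

section Reduction

variable {K ι : Type*} [Field K] {O : ValuationSubring K}

theorem exists_isReduction [Finite ι] {X : Matrix ι ι K} (hX : X ≠ 0) : ∃ P, IsReduction O X P := by
  obtain ⟨i₀, j₀, h₀⟩ : ∃ i j, X i j ≠ 0 := by
    by_contra! h
    exact hX (Matrix.ext h)
  have : Nonempty (ι × ι) := ⟨(i₀, j₀)⟩
  obtain ⟨⟨i, j⟩, hmax⟩ := Finite.exists_max fun q : ι × ι => O.valuation (X q.1 q.2)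
  have hne : X i j ≠ 0 := by
    intro h
    have := hmax (i₀, j₀)
    simp only [h, map_zero, le_zero_iff, map_eq_zero] at this
    exact h₀ this
  have hmem : ∀ k l, (X i j)⁻¹ * X k l ∈ O := by
    intro k l
    rw [← O.valuation_le_one_iff, map_mul, map_inv₀]
    have h1 := hmax (k, l)
    have h2 : O.valuation (X i j) ≠ 0 := by simpa using hne
    calc _ ≤ (O.valuation (X i j))⁻¹ * O.valuation (X i j) := by gcongr
      _ = 1 := inv_mul_cancel₀ h2
  let Y : Matrix ι ι O := Matrix.of fun k l => ⟨_, hmem k l⟩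
  refine ⟨Y.map (IsLocalRing.residue O), ?_, (X i j)⁻¹, Y, inv_ne_zero hne, ?_, rfl⟩
  · intro h
    have h1 := congrFun (congrFun h i) j
    have h2 : Y i j = 1 := Subtype.ext (inv_mul_cancel₀ hne)
    simp [h2] at h1
  · ext k l
    simp [Y]

theorem IsReduction.mul [Fintype ι] {X X' : Matrix ι ι K}
    {P P' : Matrix ι ι (IsLocalRing.ResidueField O)}
    (h : IsReduction O X P) (h' : IsReduction O X' P') (hne : P * P' ≠ 0) :
    IsReduction O (X * X') (P * P') := by
  obtain ⟨-, a, Y, ha, hY, rfl⟩ := h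
  obtain ⟨-, a', Y', ha', hY', rfl⟩ := h'
  refine ⟨hne, a * a', Y * Y', mul_ne_zero ha ha', ?_, ?_⟩
  · rw [Matrix.map_mul, hY, hY']
    simp [mul_smul]
    rw [smul_comm]
  · rw [Matrix.map_mul]

/-- A reduction of the identity has full rank. -/
theorem IsReduction.rank_of_one [Fintype ι] [DecidableEq ι]
    {P : Matrix ι ι (IsLocalRing.ResidueField O)}
    (h : IsReduction O 1 P) : P.rank = Fintype.card ι := by
  obtain ⟨hP, a, Y, ha, hY, rfl⟩ := h
  have hoff : ∀ i j, i ≠ j → Y i j = 0 := by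
    intro i j hij
    have := congrFun (congrFun hY i) j
    simpa [hij] using this
  have hdiag : ∀ i, (Y i i : K) = a := by
    intro i
    have := congrFun (congrFun hY i) i
    simpa using this
  rcases isEmpty_or_nonempty ι with hι | ⟨⟨i₀⟩⟩
  · exact absurd (Subsingleton.elim _ _) hP
  have hYd : Y = Matrix.diagonal fun _ => Y i₀ i₀ := by
    ext i j
    by_cases hij : i = j
    · subst hij
      simp [hdiag]
    · simp [hij, hoff i j hij]
  have hPd : Y.map (IsLocalRing.residue O) =
      Matrix.diagonal fun _ => IsLocalRing.residue O (Y i₀ i₀) := by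
    rw [hYd, Matrix.diagonal_map (map_zero _)]
    simp
  have hne : IsLocalRing.residue O (Y i₀ i₀) ≠ 0 := by
    intro h0
    apply hP
    rw [hPd, h0]
    simp
  rw [hPd]
  apply Matrix.rank_of_isUnit
  rw [Matrix.isUnit_iff_isUnit_det]
  simp [hne]

/-- If `(X i j) ^ d / det X` is not integral then the reduction of `X` is singular. -/
theorem IsReduction.rank_lt [Fintype ι] [DecidableEq ι] {X : Matrix ι ι K}
    {P : Matrix ι ι (IsLocalRing.ResidueField O)}
    (h : IsReduction O X P) (i j : ι) (hO : X i j ^ Fintype.card ι / X.det ∉ O) :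
    P.rank < Fintype.card ι := by
  refine lt_of_le_of_ne (Matrix.rank_le_card_width P) fun hr => hO ?_
  obtain ⟨hP, a, Y, ha, hY, rfl⟩ := h
  have hu : IsUnit (Y.map (IsLocalRing.residue O)) := by
    rw [← Matrix.mulVec_surjective_iff_isUnit]
    have : LinearMap.range (Y.map (IsLocalRing.residue O)).mulVecLin = ⊤ := by
      apply Submodule.eq_top_of_finrank_eq
      rw [Module.finrank_fintype_fun_eq_card]
      exact hr
    exact LinearMap.range_eq_top.1 this
  have hdet : IsUnit Y.det := by
    rw [Matrix.isUnit_iff_isUnit_det, ← RingHom.mapMatrix_apply, ← RingHom.map_det] at hu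
    exact (IsLocalHom.map_nonunit _ hu)
  obtain ⟨u, hu⟩ := hdet
  have h1 : ((Y.det : O) : K) = a ^ Fintype.card ι * X.det := by
    have := congrArg Matrix.det hY
    rw [Matrix.det_smul, ← RingHom.mapMatrix_apply, ← RingHom.map_det] at this
    exact this
  have h2 : ((Y i j : O) : K) = a * X i j := by
    have := congrFun (congrFun hY i) j
    simpa using this
  have h3 : ((u : O) : K) * ((↑u⁻¹ : O) : K) = 1 := by
    exact congrArg (fun x : O => (x : K)) u.mul_inv
  have h4 : X i j ^ Fintype.card ι / X.det = ((Y i j ^ Fintype.card ι * (↑u⁻¹ : O) : O) : K) := by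
    have hdX : X.det ≠ 0 := by
      intro h0
      rw [h0, mul_zero, ← hu] at h1
      rw [h1, zero_mul] at h3
      exact zero_ne_one h3
    push_cast
    rw [h2, div_eq_iff hdX, mul_pow]
    rw [← hu] at h1
    have : X.det = (a ^ Fintype.card ι)⁻¹ * ((u : O) : K) := by
      rw [h1]; field_simp
    rw [this]
    have ha' : a ^ Fintype.card ι ≠ 0 := pow_ne_zero _ ha
    calc _ = X i j ^ Fintype.card ι * (a ^ Fintype.card ι * (a ^ Fintype.card ι)⁻¹) *
              (((u : O) : K) * ((↑u⁻¹ : O) : K)) := by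
            rw [h3, mul_inv_cancel₀ ha']; ring
      _ = _ := by ring
  rw [h4]
  exact SetLike.coe_mem _

variable {F : Subfield K}

/-- Reduction of constants, when the constant field is contained in the valuation ring. -/
noncomputable def residueOfLE (hF : F.toSubring ≤ O.toSubring) :
    F →+* IsLocalRing.ResidueField O :=
  (IsLocalRing.residue O).comp (Subring.inclusion hF)

theorem isReduction_map (hF : F.toSubring ≤ O.toSubring) {C : Matrix ι ι F} (hC : C ≠ 0) :
    IsReduction O (C.map F.subtype) (C.map (residueOfLE hF)) := by
  refine ⟨?_, 1, C.map (Subring.inclusion hF), one_ne_zero, ?_, ?_⟩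
  · intro h
    apply hC
    have : Function.Injective (fun M : Matrix ι ι F => M.map (residueOfLE hF)) :=
      Matrix.map_injective (residueOfLE hF).injective
    apply this
    simpa using h
  · ext i j
    simp
  · ext i j
    simp [residueOfLE]

end Reduction

/-- A product of matrices whose rank is that of its last factor has the kernel of that factor. -/
theorem Matrix.mul_mul_ne_zero_of_rank_eq {k ι : Type*} [Field k] [Fintype ι] [DecidableEq ι]
    {X P Q : Matrix ι ι k} (h : (X * P).rank = P.rank) (hPQ : P * Q ≠ 0) : X * P * Q ≠ 0 := by
  have hker : LinearMap.ker P.mulVecLin = LinearMap.ker (X * P).mulVecLin := by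
    apply Submodule.eq_of_le_of_finrank_eq
    · intro v hv
      simp only [LinearMap.mem_ker, Matrix.mulVecLin_apply] at hv ⊢
      rw [← Matrix.mulVec_mulVec, hv, Matrix.mulVec_zero]
    · have h1 := LinearMap.finrank_range_add_finrank_ker P.mulVecLin
      have h2 := LinearMap.finrank_range_add_finrank_ker (X * P).mulVecLin
      unfold Matrix.rank at h
      omega
  intro h0
  apply hPQ
  refine Matrix.ext_of_mulVec_single fun i => ?_
  rw [← Matrix.mulVec_mulVec, Matrix.zero_mulVec]
  have h1 : Q.mulVec (Pi.single i 1) ∈ LinearMap.ker (X * P).mulVecLin := by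
    simp only [LinearMap.mem_ker, Matrix.mulVecLin_apply]
    rw [Matrix.mulVec_mulVec, h0, Matrix.zero_mulVec]
  rw [← hker] at h1
  simpa using h1

section Generic

/-- If almost every element avoids each proper subspace, for finitely many maps at a time, then
there is a sequence all of whose infinite subsequences span. -/
theorem exists_generic_sequence {N K V T : Type*} [Field K] [AddCommGroup V] [Module K V]
    [FiniteDimensional K V] [Finite T] {l : Filter N} [l.NeBot] (θ : T → N → V)
    (hnull : ∀ t, ∀ W : Submodule K V, W ≠ ⊤ → ∀ᶠ x in l, θ t x ∉ W) :
    ∃ f : ℕ → N, ∀ t, ∀ J : Set ℕ, J.Infinite →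
      Submodule.span K ((fun j => θ t (f j)) '' J) = ⊤ := by
  classical
  have hpick : ∀ S : Finset N, ∃ x, ∀ t, ∀ s ∈ S.powerset,
      Submodule.span K (θ t '' (s : Set N)) ≠ ⊤ → θ t x ∉ Submodule.span K (θ t '' (s : Set N)) := by
    intro S
    have : ∀ᶠ x in l, ∀ t, ∀ s ∈ S.powerset, Submodule.span K (θ t '' (s : Set N)) ≠ ⊤ →
        θ t x ∉ Submodule.span K (θ t '' (s : Set N)) := by
      rw [Filter.eventually_all]
      intro t
      rw [Filter.eventually_all_finset]
      intro s _
      by_cases hW : Submodule.span K (θ t '' (s : Set N)) = ⊤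
      · simp [hW]
      · filter_upwards [hnull t _ hW] with x hx _ using hx
    exact this.exists
  choose pick hpick using hpick
  let g : ℕ → Finset N := fun j => Nat.rec ∅ (fun _ S => insert (pick S) S) j
  have hg : ∀ j, g (j + 1) = insert (pick (g j)) (g j) := fun j => rfl
  have hmono : Monotone g := monotone_nat_of_le_succ fun j => by
    rw [hg]
    exact Finset.subset_insert _ _
  have hmem : ∀ i j, i < j → pick (g i) ∈ g j := by
    intro i j hij
    apply hmono (Nat.succ_le_of_lt hij)
    rw [Nat.succ_eq_add_one, hg]
    exact Finset.mem_insert_self _ _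
  refine ⟨fun j => pick (g j), fun t J hJ => ?_⟩
  by_contra hW
  obtain ⟨s, hsJ, hs⟩ := Submodule.fg_span_iff_fg_span_finset_subset
    ((fun j => θ t (pick (g j))) '' J) |>.1 (IsNoetherian.noetherian (R := K) _)
  obtain ⟨J', hJ'J, hJ's⟩ := Finset.subset_set_image_iff.1 hsJ
  obtain ⟨j, hj, hlt⟩ := hJ.exists_gt (J'.sup id)
  refine hpick (g j) t (J'.image fun i => pick (g i)) ?_ ?_ ?_
  · rw [Finset.mem_powerset]
    intro x hx
    obtain ⟨i, hi, rfl⟩ := Finset.mem_image.1 hx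
    exact hmem i j (lt_of_le_of_lt (Finset.le_sup (f := id) hi) hlt)
  all_goals
    have heq : θ t '' ((J'.image fun i => pick (g i) : Finset N) : Set N) = (s : Set V) := by
      rw [← hJ's]
      ext v
      simp
    rw [heq, ← hs]
  · exact hW
  · exact Submodule.subset_span ⟨j, hj, rfl⟩

/-- Finitely many binary constraints between distinct variables, each cofinitely satisfied in
each variable, can be satisfied simultaneously. -/
theorem exists_assignment {V κ : Type*} [Finite V] [Finite κ] (p q : κ → V)
    (hpq : ∀ c, p c ≠ q c) (R : κ → ℕ → ℕ → Prop)
    (h₁ : ∀ c x, {y | ¬ R c x y}.Finite) (h₂ : ∀ c y, {x | ¬ R c x y}.Finite) :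
    ∃ σ : V → ℕ, ∀ c, R c (σ (p c)) (σ (q c)) := by
  classical
  have := Fintype.ofFinite V
  suffices ∀ S : Finset V, ∃ σ : V → ℕ, ∀ c, p c ∈ S → q c ∈ S → R c (σ (p c)) (σ (q c)) by
    obtain ⟨σ, hσ⟩ := this Finset.univ
    exact ⟨σ, fun c => hσ c (Finset.mem_univ _) (Finset.mem_univ _)⟩
  intro S
  induction S using Finset.induction with
  | empty => exact ⟨fun _ => 0, fun c h => absurd h (Finset.notMem_empty _)⟩
  | insert v S _ ih =>
    obtain ⟨σ, hσ⟩ := ih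
    have hev : ∀ᶠ x in Filter.cofinite, ∀ c, R c (σ (p c)) x ∧ R c x (σ (q c)) := by
      rw [Filter.eventually_all]
      intro c
      exact (Filter.eventually_cofinite.2 (h₁ c _)).and (Filter.eventually_cofinite.2 (h₂ c _))
    obtain ⟨x, hx⟩ := hev.exists
    refine ⟨Function.update σ v x, fun c hp hq => ?_⟩
    by_cases hpv : p c = v
    · have hqv : q c ≠ v := fun h => hpq c (hpv.trans h.symm)
      rw [hpv, Function.update_self, Function.update_of_ne hqv]
      exact (hx c).2
    · by_cases hqv : q c = v
      · rw [hqv, Function.update_self, Function.update_of_ne hpv]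
        exact (hx c).1
      · rw [Function.update_of_ne hpv, Function.update_of_ne hqv]
        exact hσ c ((Finset.mem_insert.1 hp).resolve_left hpv)
          ((Finset.mem_insert.1 hq).resolve_left hqv)

/-- Matrices over a subfield that span over the big field span over the subfield. -/
theorem span_eq_top_of_span_map_eq_top {K ι : Type*} [Field K] [Fintype ι] [DecidableEq ι]
    {F : Subfield K} {S : Set (Matrix ι ι F)}
    (hS : Submodule.span K ((fun C : Matrix ι ι F => C.map F.subtype) '' S) = ⊤) :
    Submodule.span F S = ⊤ := by
  by_contra hne
  obtain ⟨φ, hφ, hker⟩ := Submodule.exists_le_ker_of_lt_top _ (lt_top_iff_ne_top.2 hne)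
  have hsum : ∀ X : Matrix ι ι F, φ X = ∑ i, ∑ j, X i j * φ (Matrix.single i j 1) := by
    intro X
    conv_lhs => rw [Matrix.matrix_eq_sum_single X]
    simp only [map_sum]
    refine Finset.sum_congr rfl fun i _ => Finset.sum_congr rfl fun j _ => ?_
    rw [← smul_eq_mul, ← map_smul, Matrix.smul_single, smul_eq_mul, mul_one]
  let L : Matrix ι ι K →ₗ[K] K :=
    ∑ i, ∑ j, ((φ (Matrix.single i j 1) : F) : K) • Matrix.entryLinearMap K K i j
  have hL : ∀ X : Matrix ι ι K, L X = ∑ i, ∑ j, ((φ (Matrix.single i j 1) : F) : K) * X i j := by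
    intro X
    simp [L, LinearMap.sum_apply]
  have hL0 : L = 0 := by
    rw [← LinearMap.ker_eq_top, ← top_le_iff, ← hS, Submodule.span_le]
    rintro _ ⟨C, hC, rfl⟩
    have h0 : φ C = 0 := hker (Submodule.subset_span hC)
    rw [SetLike.mem_coe, LinearMap.mem_ker, hL]
    rw [hsum] at h0
    have := congrArg F.subtype h0
    simp only [map_sum, map_mul, map_zero] at this
    rw [← this]
    refine Finset.sum_congr rfl fun i _ => Finset.sum_congr rfl fun j _ => ?_
    simp [mul_comm]
  apply hφ
  refine LinearMap.ext fun X => ?_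
  rw [hsum, LinearMap.zero_apply]
  apply Finset.sum_eq_zero
  intro i _
  apply Finset.sum_eq_zero
  intro j _
  have := congrArg (fun f => f (Matrix.single i j 1)) hL0
  simp only [LinearMap.zero_apply, hL] at this
  rw [Finset.sum_eq_single i, Finset.sum_eq_single j] at this
  · have : φ (Matrix.single i j 1) = 0 := by simpa using this
    rw [this]; simp
  · intro b _ hb; simp [hb.symm]
  · simp
  · intro b _ hb; simp [hb.symm]
  · simp

theorem finite_setOf_mul_map_mul_eq_zero {K k ι : Type*} [Field K] [Field k] [Fintype ι]
    [DecidableEq ι] {F : Subfield K} (r : F →+* k) (C : ℕ → Matrix ι ι F)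
    (hC : ∀ J : Set ℕ, J.Infinite →
      Submodule.span K ((fun j => (C j).map F.subtype) '' J) = ⊤)
    {A B : Matrix ι ι k} (hA : A ≠ 0) (hB : B ≠ 0) :
    {j | A * (C j).map r * B = 0}.Finite := by
  by_contra hJ
  have h1 := hC _ hJ
  have h2 : Submodule.span F (C '' {j | A * (C j).map r * B = 0}) = ⊤ := by
    apply span_eq_top_of_span_map_eq_top
    rw [Set.image_image]
    exact h1
  have h3 : ∀ X : Matrix ι ι F, A * X.map r * B = 0 := by
    intro X
    have hX : X ∈ Submodule.span F (C '' {j | A * (C j).map r * B = 0}) := h2 ▸ Submodule.mem_top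
    induction hX using Submodule.span_induction with
    | mem x hx =>
      obtain ⟨j, hj, rfl⟩ := hx
      exact hj
    | zero => simp [Matrix.map_zero]
    | add x y _ _ hx hy =>
      rw [Matrix.map_add r (map_add r), Matrix.mul_add, Matrix.add_mul, hx, hy, add_zero]
    | smul a x _ hx =>
      have : (a • x).map r = r a • x.map r := by
        ext i j
        simp
      rw [this, Matrix.mul_smul, Matrix.smul_mul, hx, smul_zero]
  obtain ⟨a, i, hai⟩ : ∃ a i, A a i ≠ 0 := by
    by_contra! h
    exact hA (Matrix.ext h)
  obtain ⟨j, b, hjb⟩ : ∃ j b, B j b ≠ 0 := by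
    by_contra! h
    exact hB (Matrix.ext h)
  have h4 := congrFun (congrFun (h3 (Matrix.single i j 1)) a) b
  rw [Matrix.map_single (f := r)] at h4
  simp [Matrix.mul_apply, Matrix.single_apply, Finset.sum_ite_eq, ite_and, hai, hjb] at h4

end Generic

section PingPong

variable {N K ι Γ I : Type*} [Group N] [Field K] [Fintype ι] [DecidableEq ι]
  {O : ValuationSubring K} {ρ : N →* Matrix ι ι K} {c : Γ → MulAut N} {S : Finset Γ}
  {f : ℕ → N} {D : Γ → Bool → ℕ → Matrix ι ι (IsLocalRing.ResidueField O)} {m : ℕ}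

/-- Some element has reductions of minimal rank in all finitely many twists simultaneously. -/
theorem exists_forall_rank_eq [Nonempty ι]
    (hD : ∀ γ ∈ S, ∀ b j, IsReduction O (ρ (c γ (cond b (f j) (f j)⁻¹))) (D γ b j))
    (hfin : ∀ γ ∈ S, ∀ b, ∀ A B : Matrix ι ι (IsLocalRing.ResidueField O), A ≠ 0 → B ≠ 0 →
      {j | A * D γ b j * B = 0}.Finite)
    (hmin : ∀ x P, IsReduction O (ρ x) P → m ≤ P.rank)
    (hatt : ∃ x P, IsReduction O (ρ x) P ∧ P.rank = m) :
    ∃ g, ∀ γ ∈ S, ∀ b, ∃ P, IsReduction O (ρ (c γ (cond b g g⁻¹))) P ∧ P.rank = m := by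
  classical
  have hρ : ∀ x, ρ x ≠ 0 := by
    intro x h
    have : ρ x * ρ x⁻¹ = 1 := by rw [← map_mul, mul_inv_cancel, map_one]
    rw [h, zero_mul] at this
    exact zero_ne_one this
  suffices ∀ U ⊆ S ×ˢ (Finset.univ : Finset Bool), ∃ g, ∀ t ∈ U,
      ∃ P, IsReduction O (ρ (c t.1 (cond t.2 g g⁻¹))) P ∧ P.rank = m by
    obtain ⟨g, hg⟩ := this _ subset_rfl
    exact ⟨g, fun γ hγ b => hg (γ, b) (by simp [hγ])⟩
  intro U
  induction U using Finset.induction with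
  | empty => exact fun _ => ⟨1, fun t ht => absurd ht (Finset.notMem_empty _)⟩
  | insert t₀ U _ ih =>
    intro hU
    obtain ⟨g, hg⟩ := ih ((Finset.subset_insert _ _).trans hU)
    obtain ⟨x, P₀, hx, hP₀⟩ := hatt
    obtain ⟨g', hg'⟩ : ∃ g', c t₀.1 (cond t₀.2 g' g'⁻¹) = x := by
      cases h : t₀.2
      · exact ⟨((c t₀.1).symm x)⁻¹, by simp⟩
      · exact ⟨(c t₀.1).symm x, by simp⟩
    have hP : ∀ t : Γ × Bool, ∃ P, IsReduction O (ρ (c t.1 (cond t.2 g g⁻¹))) P ∧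
        (t ∈ U → P.rank = m) := by
      intro t
      by_cases ht : t ∈ U
      · obtain ⟨P, h1, h2⟩ := hg t ht
        exact ⟨P, h1, fun _ => h2⟩
      · obtain ⟨P, h1⟩ := exists_isReduction (O := O) (hρ (c t.1 (cond t.2 g g⁻¹)))
        exact ⟨P, h1, fun h => absurd h ht⟩
    have hQ : ∀ t : Γ × Bool, ∃ Q, IsReduction O (ρ (c t.1 (cond t.2 g' g'⁻¹))) Q ∧
        (t = t₀ → Q.rank = m) := by
      intro t
      by_cases ht : t = t₀
      · subst ht
        exact ⟨P₀, hg' ▸ hx, fun _ => hP₀⟩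
      · obtain ⟨P, h1⟩ := exists_isReduction (O := O) (hρ (c t.1 (cond t.2 g' g'⁻¹)))
        exact ⟨P, h1, fun h => absurd h ht⟩
    choose P hP hPm using hP
    choose Q hQ hQm using hQ
    have hev : ∀ᶠ j in Filter.cofinite, ∀ t ∈ insert t₀ U,
        P t * D t.1 t.2 j * Q t ≠ 0 ∧ Q t * D t.1 t.2 j * P t ≠ 0 := by
      rw [Filter.eventually_all_finset]
      intro t ht
      have hS : t.1 ∈ S := (Finset.mem_product.1 (hU ht)).1
      refine Filter.Eventually.and ?_ ?_
      · simpa [Filter.eventually_cofinite] using hfin t.1 hS t.2 (P t) (Q t) (hP t).1 (hQ t).1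
      · simpa [Filter.eventually_cofinite] using hfin t.1 hS t.2 (Q t) (P t) (hQ t).1 (hP t).1
    obtain ⟨j, hj⟩ := hev.exists
    refine ⟨g * f j * g', fun t ht => ?_⟩
    have hS : t.1 ∈ S := (Finset.mem_product.1 (hU ht)).1
    have hDt := hD t.1 hS t.2 j
    have hPt := hP t
    have hQt := hQ t
    obtain ⟨hj1, hj2⟩ := hj t ht
    have hle : (P t).rank = m ∨ (Q t).rank = m := by
      rcases Finset.mem_insert.1 ht with h | h
      · exact Or.inr (hQm t h)
      · exact Or.inl (hPm t h)
    rcases ht2 : t.2 with _ | _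
    · rw [ht2] at hDt hPt hQt hj2
      have key := (hQt.mul hDt (left_ne_zero_of_mul hj2)).mul hPt hj2
      have heq : c t.1 (cond false (g * f j * g') (g * f j * g')⁻¹) =
          c t.1 (cond false g' g'⁻¹) * c t.1 (cond false (f j) (f j)⁻¹) *
            c t.1 (cond false g g⁻¹) := by
        simp [mul_assoc]
      rw [← map_mul, ← map_mul, ← heq] at key
      refine ⟨_, key, le_antisymm ?_ (hmin _ _ key)⟩
      rcases hle with h | h
      · exact h ▸ Matrix.rank_mul_le_right _ _
      · exact h ▸ (Matrix.rank_mul_le_left _ _).trans (Matrix.rank_mul_le_left _ _)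
    · rw [ht2] at hDt hPt hQt hj1
      have key := (hPt.mul hDt (left_ne_zero_of_mul hj1)).mul hQt hj1
      have heq : c t.1 (cond true (g * f j * g') (g * f j * g')⁻¹) =
          c t.1 (cond true g g⁻¹) * c t.1 (cond true (f j) (f j)⁻¹) *
            c t.1 (cond true g' g'⁻¹) := by
        simp [mul_assoc]
      rw [← map_mul, ← map_mul, ← heq] at key
      refine ⟨_, key, le_antisymm ?_ (hmin _ _ key)⟩
      rcases hle with h | h
      · exact h ▸ (Matrix.rank_mul_le_left _ _).trans (Matrix.rank_mul_le_left _ _)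
      · exact h ▸ Matrix.rank_mul_le_right _ _

/-- Ping-pong: if some reduction is singular, a nonempty reduced twisted word is nontrivial at a
suitable point. -/
theorem exists_twisted_word_ne_one_of_reduction [Nonempty ι] [Finite I]
    (hD : ∀ γ ∈ S, ∀ b j, IsReduction O (ρ (c γ (cond b (f j) (f j)⁻¹))) (D γ b j))
    (hDinv : ∀ γ ∈ S, ∀ b j, D γ b j * D γ (!b) j = 1)
    (hfin : ∀ γ ∈ S, ∀ b, ∀ A B : Matrix ι ι (IsLocalRing.ResidueField O), A ≠ 0 → B ≠ 0 →
      {j | A * D γ b j * B = 0}.Finite)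
    (hsing : ∃ x P, IsReduction O (ρ x) P ∧ P.rank < Fintype.card ι)
    (L : List (I × Bool × Γ)) (hL : L ≠ []) (hLS : ∀ q ∈ L, q.2.2 ∈ S)
    (hchain : L.IsChain fun q q' => q.1 = q'.1 → q.2.1 = q'.2.1) :
    ∃ y : I → N, (L.map fun q => c q.2.2 (cond q.2.1 (y q.1) (y q.1)⁻¹)).prod ≠ 1 := by
  classical
  obtain ⟨m, hmin, hatt, hm⟩ : ∃ m, (∀ x P, IsReduction O (ρ x) P → m ≤ P.rank) ∧
      (∃ x P, IsReduction O (ρ x) P ∧ P.rank = m) ∧ m < Fintype.card ι := by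
    have hex : ∃ m, ∃ x P, IsReduction O (ρ x) P ∧ P.rank = m := by
      obtain ⟨x, P, h, -⟩ := hsing
      exact ⟨_, x, P, h, rfl⟩
    refine ⟨Nat.find hex, fun x P h => Nat.find_min' hex ⟨x, P, h, rfl⟩, Nat.find_spec hex, ?_⟩
    obtain ⟨x, P, h, hlt⟩ := hsing
    exact (Nat.find_min' hex ⟨x, P, h, rfl⟩).trans_lt hlt
  obtain ⟨g, hg⟩ := exists_forall_rank_eq hD hfin hmin hatt
  choose! P hP hPm using hg
  have hDl : ∀ γ ∈ S, ∀ b j, ∀ A : Matrix ι ι (IsLocalRing.ResidueField O), A ≠ 0 →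
      D γ b j * A ≠ 0 := by
    intro γ hγ b j A hA h
    apply hA
    have h1 := hDinv γ hγ (!b) j
    rw [Bool.not_not] at h1
    rw [← one_mul A, ← h1, mul_assoc, h, mul_zero]
  have hDr : ∀ γ ∈ S, ∀ b j, ∀ A : Matrix ι ι (IsLocalRing.ResidueField O), A ≠ 0 →
      A * D γ b j ≠ 0 := by
    intro γ hγ b j A hA h
    apply hA
    rw [← mul_one A, ← hDinv γ hγ b j, ← mul_assoc, h, zero_mul]
  let κ := {qq : (I × Bool × Γ) × (I × Bool × Γ) // qq ∈ L.toFinset ×ˢ L.toFinset ∧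
    (qq.1.1, !qq.1.2.1) ≠ (qq.2.1, qq.2.2.1)}
  have : Finite κ := Set.Finite.subset (L.toFinset ×ˢ L.toFinset).finite_toSet
    (fun qq h => h.1)
  have hκ : ∀ qq : κ, qq.1.1.2.2 ∈ S ∧ qq.1.2.2.2 ∈ S := by
    rintro ⟨qq, h, -⟩
    rw [Finset.mem_product, List.mem_toFinset, List.mem_toFinset] at h
    exact ⟨hLS _ h.1, hLS _ h.2⟩
  obtain ⟨σ, hσ⟩ := exists_assignment (V := I × Bool) (κ := κ)
    (fun qq => (qq.1.1.1, !qq.1.1.2.1)) (fun qq => (qq.1.2.1, qq.1.2.2.1)) (fun qq => qq.2.2)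
    (fun qq x y => P qq.1.1.2.2 qq.1.1.2.1 * D qq.1.1.2.2 qq.1.1.2.1 x *
      (D qq.1.2.2.2 qq.1.2.2.1 y * P qq.1.2.2.2 qq.1.2.2.1) ≠ 0)
    (by
      intro qq x
      obtain ⟨h1, h2⟩ := hκ qq
      have := hfin _ h2 qq.1.2.2.1 _ _ (hDr _ h1 qq.1.1.2.1 x _ (hP _ h1 qq.1.1.2.1).1)
        (hP _ h2 qq.1.2.2.1).1
      simpa [mul_assoc] using this)
    (by
      intro qq y
      obtain ⟨h1, h2⟩ := hκ qq
      have := hfin _ h1 qq.1.1.2.1 _ _ (hP _ h1 qq.1.1.2.1).1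
        (hDl _ h2 qq.1.2.2.1 y _ (hP _ h2 qq.1.2.2.1).1)
      simpa using this)
  have hjunction : ∀ q ∈ L, ∀ q' ∈ L, (q.1 = q'.1 → q.2.1 = q'.2.1) →
      P q.2.2 q.2.1 * (D q.2.2 q.2.1 (σ (q.1, !q.2.1)) *
      (D q'.2.2 q'.2.1 (σ (q'.1, q'.2.1)) * P q'.2.2 q'.2.1)) ≠ 0 := by
    intro q hq q' hq' h
    rw [← mul_assoc]
    refine hσ ⟨(q, q'), ?_, ?_⟩
    · simp [hq, hq']
    · intro h'
      rw [Prod.mk.injEq] at h'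
      have := h h'.1
      rw [← this] at h'
      simp at h'
  let y : I → N := fun i => f (σ (i, true)) * g * f (σ (i, false))
  have hy : ∀ q : I × Bool × Γ, c q.2.2 (cond q.2.1 (y q.1) (y q.1)⁻¹) =
      c q.2.2 (cond q.2.1 (f (σ (q.1, q.2.1))) (f (σ (q.1, q.2.1)))⁻¹) *
      c q.2.2 (cond q.2.1 g g⁻¹) *
      c q.2.2 (cond q.2.1 (f (σ (q.1, !q.2.1))) (f (σ (q.1, !q.2.1)))⁻¹) := by
    rintro ⟨i, b, γ⟩
    cases b <;> simp [y, mul_assoc]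
  have hstep : ∀ (L' : List (I × Bool × Γ)) (q : I × Bool × Γ) (Z : N)
      (X : Matrix ι ι (IsLocalRing.ResidueField O)), (∀ q' ∈ q :: L', q' ∈ L) →
      (q :: L').IsChain (fun q q' => q.1 = q'.1 → q.2.1 = q'.2.1) →
      IsReduction O (ρ Z) (X * P q.2.2 q.2.1) →
      Z * c q.2.2 (cond q.2.1 (f (σ (q.1, !q.2.1))) (f (σ (q.1, !q.2.1)))⁻¹) *
        (L'.map fun q => c q.2.2 (cond q.2.1 (y q.1) (y q.1)⁻¹)).prod ≠ 1 := by
    intro L'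
    induction L' with
    | nil =>
      intro q Z X hqL _ hred h1
      have hq : q.2.2 ∈ S := hLS q (hqL q (by simp))
      have key := hred.mul (hD _ hq q.2.1 (σ (q.1, !q.2.1))) (hDr _ hq _ _ _ hred.1)
      rw [List.map_nil, List.prod_nil, mul_one] at h1
      rw [← map_mul, h1, map_one] at key
      have h2 := key.rank_of_one
      have h3 := (Matrix.rank_mul_le_left (X * P q.2.2 q.2.1)
        (D q.2.2 q.2.1 (σ (q.1, !q.2.1)))).trans (Matrix.rank_mul_le_right _ _)
      rw [hPm _ hq] at h3
      omega
    | cons q' L' ih =>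
      intro q Z X hqL hch hred
      have hqL' : q ∈ L := hqL q (by simp)
      have hq'L : q' ∈ L := hqL q' (by simp)
      have hq : q.2.2 ∈ S := hLS q hqL'
      have hq' : q'.2.2 ∈ S := hLS q' hq'L
      rw [List.isChain_cons_cons] at hch
      have hrank : (X * P q.2.2 q.2.1).rank = (P q.2.2 q.2.1).rank := by
        refine le_antisymm (Matrix.rank_mul_le_right _ _) ?_
        rw [hPm _ hq]
        exact hmin _ _ hred
      have hne := Matrix.mul_mul_ne_zero_of_rank_eq hrank (hjunction q hqL' q' hq'L hch.1)
      have hne1 := hDl _ hq' q'.2.1 (σ (q'.1, q'.2.1)) _ (hP _ hq' q'.2.1).1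
      have key := hred.mul ((hD _ hq q.2.1 (σ (q.1, !q.2.1))).mul
        ((hD _ hq' q'.2.1 (σ (q'.1, q'.2.1))).mul (hP _ hq' q'.2.1) hne1)
        (hDl _ hq _ _ _ hne1)) hne
      have := ih q' (Z * (c q.2.2 (cond q.2.1 (f (σ (q.1, !q.2.1))) (f (σ (q.1, !q.2.1)))⁻¹) *
        (c q'.2.2 (cond q'.2.1 (f (σ (q'.1, q'.2.1))) (f (σ (q'.1, q'.2.1)))⁻¹) *
          c q'.2.2 (cond q'.2.1 g g⁻¹))))
        (X * P q.2.2 q.2.1 * (D q.2.2 q.2.1 (σ (q.1, !q.2.1)) *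
          D q'.2.2 q'.2.1 (σ (q'.1, q'.2.1)))) (fun q'' h => hqL q'' (List.mem_cons_of_mem _ h))
        hch.2 (by simpa [mul_assoc] using key)
      rw [List.map_cons, List.prod_cons, hy q']
      simpa only [mul_assoc] using this
  obtain ⟨q, L', rfl⟩ := List.exists_cons_of_ne_nil hL
  have hq : q.2.2 ∈ S := hLS q (by simp)
  refine ⟨y, ?_⟩
  rw [List.map_cons, List.prod_cons, hy q]
  refine hstep L' q _ (D q.2.2 q.2.1 (σ (q.1, q.2.1))) (fun _ h => h) hchain ?_
  rw [map_mul]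
  exact (hD _ hq _ _).mul (hP _ hq _) (hDl _ hq _ _ _ (hP _ hq _).1)

end PingPong

section Field

/-- An element transcendental over a subfield is excluded by a valuation ring containing the
subfield. -/
theorem exists_valuationSubring_notMem {K : Type*} [Field K] (F : Subfield K) {x : K}
    (hx : ¬ IsAlgebraic F x) : ∃ O : ValuationSubring K, F.toSubring ≤ O.toSubring ∧ x ∉ O := by
  by_contra! h
  apply hx
  have h1 : x ∈ ⨅ V : {V : ValuationSubring K // (F : Set K) ⊆ V.toSubring}, V.1.toSubring := by
    rw [Subring.mem_iInf]
    rintro ⟨V, hV⟩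
    exact h V hV
  rw [iInf_valuationSubring_superset] at h1
  obtain ⟨q, hq, hq0⟩ : IsIntegral (Subring.closure (F : Set K)) x := h1
  have hle : Subring.closure (F : Set K) ≤ F.toSubring := Subring.closure_le.2 fun _ h => h
  have hFx : IsIntegral F x := by
    refine ⟨q.map (Subring.inclusion hle : _ →+* F), hq.map _, ?_⟩
    rw [Polynomial.eval₂_map]
    exact hq0
  exact hFx.isAlgebraic

theorem Subfield.countable_closure {K : Type*} [Field K] {s : Set K} (hs : s.Countable) :
    Countable (Subfield.closure s) := by
  rw [← Cardinal.mk_le_aleph0_iff]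
  exact (Subfield.cardinalMk_closure_le_max s).trans (max_le hs.le_aleph0 le_rfl)

variable {N K ι Γ I : Type*} [Field K] [Fintype ι] [DecidableEq ι] {R : Subalgebra K (N → K)}

theorem linearMap_comp_mem {θ : N → Matrix ι ι K} (hθ : ∀ i j, (fun x => θ x i j) ∈ R)
    (φ : Matrix ι ι K →ₗ[K] K) : (fun x => φ (θ x)) ∈ R := by
  have : (fun x => φ (θ x)) = ∑ i, ∑ j, φ (Matrix.single i j 1) • fun x => θ x i j := by
    ext x
    conv_lhs => rw [Matrix.matrix_eq_sum_single (θ x)]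
    simp only [map_sum, Finset.sum_apply, Pi.smul_apply, smul_eq_mul]
    refine Finset.sum_congr rfl fun i _ => Finset.sum_congr rfl fun j _ => ?_
    rw [mul_comm, ← smul_eq_mul (a := θ x i j), ← map_smul, Matrix.smul_single, smul_eq_mul,
      mul_one]
  rw [this]
  exact sum_mem fun i _ => sum_mem fun j _ => R.smul_mem (hθ i j) _

theorem det_comp_mem {θ : N → Matrix ι ι K} (hθ : ∀ i j, (fun x => θ x i j) ∈ R) :
    (fun x => (θ x).det) ∈ R := by
  have : (fun x => (θ x).det) = ∑ s : Equiv.Perm ι,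
      ((Equiv.Perm.sign s : ℤ) : K) • ∏ i, fun x => θ x (s i) i := by
    ext x
    simp [Matrix.det_apply', Finset.prod_apply]
  rw [this]
  exact sum_mem fun s _ => R.smul_mem (prod_mem fun i _ => hθ _ _) _

variable [Group N] {ρ : N →* Matrix ι ι K} {l : Filter N}

/-- An absolutely irreducible representation of dimension at least two of a group that is
irreducible in the sense of `hR` admits no nontrivial reduced twisted law. -/
theorem exists_twisted_word_ne_one [Finite I] [l.NeBot] [CountableInterFilter l]
    {c : Γ → MulAut N} {i₀ j₀ : ι} (hij : i₀ ≠ j₀)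
    (hspan : Submodule.span K (Set.range ρ) = ⊤)
    (hR : ∀ f ∈ R, f = 0 ∨ ∀ᶠ x in l, f x ≠ 0)
    (hρR : ∀ γ b i j, (fun x => ρ (c γ (cond b x x⁻¹)) i j) ∈ R)
    (L : List (I × Bool × Γ)) (hL : L ≠ [])
    (hchain : L.IsChain fun q q' => q.1 = q'.1 → q.2.1 = q'.2.1) :
    ∃ y : I → N, (L.map fun q => c q.2.2 (cond q.2.1 (y q.1) (y q.1)⁻¹)).prod ≠ 1 := by
  classical
  have : Nonempty ι := ⟨i₀⟩
  let S : Finset Γ := (L.map fun q => q.2.2).toFinset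
  have hsurj : ∀ γ b, Function.Surjective fun x : N => c γ (cond b x x⁻¹) := by
    intro γ b x
    cases b
    · exact ⟨((c γ).symm x)⁻¹, by simp⟩
    · exact ⟨(c γ).symm x, by simp⟩
  have hnull : ∀ t : S × Bool, ∀ W : Submodule K (Matrix ι ι K), W ≠ ⊤ →
      ∀ᶠ x in l, ρ (c t.1 (cond t.2 x x⁻¹)) ∉ W := by
    intro t W hW
    obtain ⟨φ, hφ, hker⟩ := Submodule.exists_le_ker_of_lt_top _ (lt_top_iff_ne_top.2 hW)
    rcases hR _ (linearMap_comp_mem (hρR t.1 t.2) φ) with h0 | h0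
    · exfalso
      apply hφ
      rw [← LinearMap.ker_eq_top, ← top_le_iff, ← hspan, Submodule.span_le]
      rintro _ ⟨x, rfl⟩
      obtain ⟨x, rfl⟩ := hsurj t.1 t.2 x
      exact congrFun h0 x
    · filter_upwards [h0] with x hx hxW using hx (hker hxW)
  obtain ⟨f, hf⟩ := exists_generic_sequence (T := S × Bool) (l := l)
    (fun t x => ρ (c t.1 (cond t.2 x x⁻¹))) hnull
  let F : Subfield K := Subfield.closure (Set.range fun q : ℕ × (S × Bool) × ι × ι =>
    ρ (c q.2.1.1 (cond q.2.1.2 (f q.1) (f q.1)⁻¹)) q.2.2.1 q.2.2.2)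
  have : Countable F := Subfield.countable_closure (Set.countable_range _)
  have hdet : ∀ x, (ρ x).det ≠ 0 := by
    intro x h
    have h1 : (ρ x * ρ x⁻¹).det = 1 := by rw [← map_mul, mul_inv_cancel, map_one, Matrix.det_one]
    rw [Matrix.det_mul, h, zero_mul] at h1
    exact zero_ne_one h1
  have htr : ∃ x, ¬ IsAlgebraic F (ρ x i₀ j₀ ^ Fintype.card ι / (ρ x).det) := by
    obtain ⟨q, hq⟩ := List.exists_mem_of_ne_nil L hL
    have hev : ∀ᶠ x in l, ∀ a ∈ {a : K | IsAlgebraic F a},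
        ρ (c q.2.2 x) i₀ j₀ ^ Fintype.card ι - a * (ρ (c q.2.2 x)).det ≠ 0 := by
      rw [eventually_countable_ball (Algebraic.countable F K)]
      intro a _
      have hmem : (fun x => ρ (c q.2.2 x) i₀ j₀ ^ Fintype.card ι -
          a * (ρ (c q.2.2 x)).det) ∈ R :=
        sub_mem (pow_mem (hρR q.2.2 true i₀ j₀) _)
          (R.smul_mem (det_comp_mem (hρR q.2.2 true)) a)
      refine (hR _ hmem).resolve_left fun h0 => ?_
      have ha : a = 0 := by
        have := congrFun h0 1
        simpa [hij] using this
      have hzero : ∀ x, ρ x i₀ j₀ = 0 := by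
        intro x
        have := congrFun h0 ((c q.2.2).symm x)
        simpa [ha] using this
      have : Matrix.entryLinearMap K K i₀ j₀ = 0 := by
        rw [← LinearMap.ker_eq_top, ← top_le_iff, ← hspan, Submodule.span_le]
        rintro _ ⟨x, rfl⟩
        exact hzero x
      have := congrArg (fun φ => φ (Matrix.single i₀ j₀ 1)) this
      simp at this
    obtain ⟨x, hx⟩ := hev.exists
    refine ⟨c q.2.2 x, fun h => hx _ h ?_⟩
    rw [div_mul_cancel₀ _ (hdet _), sub_self]
  obtain ⟨x₀, hx₀⟩ := htr
  obtain ⟨O, hFO, hxO⟩ := exists_valuationSubring_notMem F hx₀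
  have hmemF : ∀ γ ∈ S, ∀ b j i k, ρ (c γ (cond b (f j) (f j)⁻¹)) i k ∈ F := fun γ hγ b j i k =>
    Subfield.subset_closure ⟨(j, (⟨γ, hγ⟩, b), i, k), rfl⟩
  let C : Γ → Bool → ℕ → Matrix ι ι F := fun γ b j => Matrix.of fun i k =>
    if hγ : γ ∈ S then ⟨_, hmemF γ hγ b j i k⟩ else 0
  have hC : ∀ γ ∈ S, ∀ b j, (C γ b j).map F.subtype = ρ (c γ (cond b (f j) (f j)⁻¹)) := by
    intro γ hγ b j
    ext i k
    simp [C, hγ]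
  have hCinv : ∀ γ ∈ S, ∀ b j, C γ b j * C γ (!b) j = 1 := by
    intro γ hγ b j
    apply Matrix.map_injective F.subtype.injective
    change (C γ b j * C γ (!b) j).map F.subtype = (1 : Matrix ι ι F).map F.subtype
    rw [Matrix.map_mul, hC γ hγ, hC γ hγ, ← map_mul, ← map_mul]
    cases b <;> simp
  refine exists_twisted_word_ne_one_of_reduction (O := O) (ρ := ρ) (S := S) (f := f)
    (D := fun γ b j => (C γ b j).map (residueOfLE hFO)) ?_ ?_ ?_ ?_ L hL ?_ hchain
  · intro γ hγ b j
    rw [← hC γ hγ]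
    refine isReduction_map hFO fun h0 => ?_
    have := hCinv γ hγ b j
    rw [h0, zero_mul] at this
    exact zero_ne_one this
  · intro γ hγ b j
    rw [← Matrix.map_mul, hCinv γ hγ]
    simp
  · intro γ hγ b A B hA hB
    refine finite_setOf_mul_map_mul_eq_zero _ (C γ b) (fun J hJ => ?_) hA hB
    simp_rw [hC γ hγ]
    exact hf (⟨γ, hγ⟩, b) J hJ
  · have hne : ρ x₀ ≠ 0 := by
      intro h0
      apply hdet x₀
      rw [h0, Matrix.det_zero]
    obtain ⟨P, hP⟩ := exists_isReduction (O := O) hne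
    exact ⟨x₀, P, hP, hP.rank_lt i₀ j₀ hxO⟩
  · intro q hq
    exact List.mem_toFinset.2 (List.mem_map.2 ⟨q, hq, rfl⟩)

end Field

section TwistedWord

/-- The letters of a word, each together with the conjugator produced by moving the prefix
in front of it, evaluated at `x`, to the right. -/
def twistedLetters {G I : Type*} [Group G] (x : I → G) : G → List (I × Bool) → List (I × Bool × G)
  | _, [] => []
  | z, q :: L => (q.1, q.2, bif q.2 then z else z * (x q.1)⁻¹) ::
      twistedLetters x (z * bif q.2 then x q.1 else (x q.1)⁻¹) L

variable {G I : Type*} [Group G]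

theorem map_twistedLetters (x : I → G) (z : G) (L : List (I × Bool)) :
    (twistedLetters x z L).map (fun q => (q.1, q.2.1)) = L := by
  induction L generalizing z with
  | nil => rfl
  | cons q L ih => simp [twistedLetters, ih]

theorem prod_twistedLetters (x : I → G) (N : Subgroup G) [N.Normal] (y : I → N) (z : G)
    (L : List (I × Bool)) :
    (((twistedLetters x z L).map fun q =>
        (MulAut.conjNormal q.2.2 : MulAut N) (cond q.2.1 (y q.1) (y q.1)⁻¹)).prod : G) *
      (z * (L.map fun q => bif q.2 then x q.1 else (x q.1)⁻¹).prod) =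
      z * (L.map fun q => bif q.2 then y q.1 * x q.1 else (y q.1 * x q.1)⁻¹).prod := by
  induction L generalizing z with
  | nil => simp [twistedLetters]
  | cons q L ih =>
    have h := ih (z * bif q.2 then x q.1 else (x q.1)⁻¹)
    simp only [twistedLetters, List.map_cons, List.prod_cons, Subgroup.coe_mul]
    rw [mul_assoc, ← mul_assoc z, h]
    rcases q with ⟨i, b⟩
    cases b <;> simp [MulAut.conjNormal_apply, mul_assoc]

/-- A word vanishing on a coset of a power of a normal subgroup gives a reduced twisted law on
that subgroup. -/
theorem exists_twisted_law {w : FreeGroup I} (hw : w ≠ 1) (N : Subgroup G) [N.Normal] (x : I → G)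
    (h : ∀ y : I → N, FreeGroup.lift (fun i => (y i : G) * x i) w = 1) :
    ∃ L : List (I × Bool × G), L ≠ [] ∧
      (L.IsChain fun q q' => q.1 = q'.1 → q.2.1 = q'.2.1) ∧
      ∀ y : I → N, (L.map fun q =>
        (MulAut.conjNormal q.2.2 : MulAut N) (cond q.2.1 (y q.1) (y q.1)⁻¹)).prod = 1 := by
  classical
  have hlift : ∀ u : I → G, FreeGroup.lift u w =
      (w.toWord.map fun q => bif q.2 then u q.1 else (u q.1)⁻¹).prod := by
    intro u
    conv_lhs => rw [← FreeGroup.mk_toWord (x := w)]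
    exact FreeGroup.lift_mk
  refine ⟨twistedLetters x 1 w.toWord, ?_, ?_, fun y => ?_⟩
  · intro h0
    have := map_twistedLetters x 1 w.toWord
    rw [h0, List.map_nil] at this
    exact hw (FreeGroup.toWord_eq_nil_iff.1 this.symm)
  · have := FreeGroup.isReduced_toWord (x := w)
    rw [← map_twistedLetters x 1 w.toWord, FreeGroup.IsReduced, List.isChain_map] at this
    exact this
  · have h1 := prod_twistedLetters x N y 1 w.toWord
    have hx : FreeGroup.lift x w = 1 := by simpa using h 1
    rw [← hlift x, ← hlift fun i => (y i : G) * x i, h y, hx, mul_one, mul_one] at h1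
    exact Subtype.ext h1

end TwistedWord

section Dichotomy

variable {X : Type*} [Group X] [MeasurableSpace X] [MeasurableMul X] {μ : Measure X}
  [μ.IsMulLeftInvariant]

theorem exists_measure_inter_preimage_ne_zero {H : Subgroup X} [H.FiniteIndex] {C : Set X}
    (hC : μ C ≠ 0) : ∃ x, μ ((H : Set X) ∩ (x * ·) ⁻¹' C) ≠ 0 := by
  by_contra! h
  apply hC
  have hsub : C ⊆ ⋃ q : X ⧸ H, (q.out⁻¹ * ·) ⁻¹' ((H : Set X) ∩ (q.out * ·) ⁻¹' C) := by
    intro c hc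
    refine Set.mem_iUnion.2 ⟨(c : X ⧸ H), ?_, ?_⟩
    · exact QuotientGroup.eq.1 (Quotient.out_eq' (c : X ⧸ H))
    · simpa using hc
  refine measure_mono_null hsub (measure_iUnion_null fun q => ?_)
  rw [measure_preimage_mul]
  exact h _

/-- A left-invariant family of measurable sets with the descending chain condition is
eventually irreducible in measure: some finite index subgroup meets every member of the family
in a null set or is contained in it. -/
theorem exists_finiteIndex_forall_subset [IsFiniteMeasure μ] [NeZero μ] {𝒵 : Set (Set X)}
    (hwf : 𝒵.WellFoundedOn (· < ·))
    (huniv : Set.univ ∈ 𝒵) (hinter : ∀ V ∈ 𝒵, ∀ W ∈ 𝒵, V ∩ W ∈ 𝒵)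
    (hpre : ∀ V ∈ 𝒵, ∀ g : X, (g * ·) ⁻¹' V ∈ 𝒵) (hmeas : ∀ V ∈ 𝒵, MeasurableSet V) :
    ∃ H : Subgroup X, H.FiniteIndex ∧ ∀ V ∈ 𝒵, μ ((H : Set X) ∩ V) ≠ 0 → (H : Set X) ⊆ V := by
  obtain ⟨V, ⟨hV𝒵, hV0⟩, hVmin⟩ := (hwf.subset (Set.sep_subset 𝒵 (μ · ≠ 0))).exists_minimal
    ⟨Set.univ, huniv, by simpa using NeZero.ne μ⟩
  have hsub : ∀ W ∈ 𝒵, μ (V ∩ W) ≠ 0 → V ⊆ W := fun W hW h =>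
    (hVmin ⟨hinter V hV𝒵 W hW, h⟩ Set.inter_subset_left).trans Set.inter_subset_right
  obtain ⟨v, hv⟩ : V.Nonempty := nonempty_of_measure_ne_zero hV0
  let τ : X → Set X := fun g => (g * ·) ⁻¹' V
  have hτ : ∀ g W, (g * ·) ⁻¹' ((g⁻¹ * ·) ⁻¹' W) = (W : Set X) := by
    intro g W
    ext x
    simp
  have hτsub : ∀ g, ∀ W ∈ 𝒵, μ (τ g ∩ W) ≠ 0 → τ g ⊆ W := by
    intro g W hW h
    have h1 : V ⊆ (g⁻¹ * ·) ⁻¹' W := by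
      refine hsub _ (hpre W hW _) ?_
      rwa [← measure_preimage_mul μ g, Set.preimage_inter, hτ]
    have := Set.preimage_mono (f := (g * ·)) h1
    rwa [hτ] at this
  have hτeq : ∀ g g', μ (τ g ∩ τ g') ≠ 0 → τ g = τ g' := by
    intro g g' h
    refine (hτsub g _ (hpre V hV𝒵 g') h).antisymm (hτsub g' _ (hpre V hV𝒵 g) ?_)
    rwa [Set.inter_comm]
  have hττ : ∀ g h, τ (g * h) = (h * ·) ⁻¹' τ g := by
    intro g h
    ext x
    simp [τ, mul_assoc]
  let H : Subgroup X :=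
    { carrier := {h | (h * ·) ⁻¹' τ v = τ v}
      one_mem' := by simp
      mul_mem' := by
        intro a b ha hb
        have : ((a * b) * ·) ⁻¹' τ v = (b * ·) ⁻¹' ((a * ·) ⁻¹' τ v) := by
          ext x
          simp [mul_assoc]
        rw [Set.mem_ofPred_eq] at ha hb ⊢
        rw [this, ha, hb]
      inv_mem' := by
        intro a ha
        rw [Set.mem_ofPred_eq] at ha ⊢
        conv_lhs => rw [← ha]
        simpa using hτ a⁻¹ (τ v) }
  have hH : ∀ {h}, h ∈ H ↔ (h * ·) ⁻¹' τ v = τ v := Iff.rfl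
  have hHsub : (H : Set X) ⊆ τ v := by
    intro h hh
    have h1 : (1 : X) ∈ τ v := by simpa [τ] using hv
    rw [← hH.1 hh] at h1
    simpa using h1
  refine ⟨H, ?_, fun W hW h => hHsub.trans (hτsub v W hW fun h0 =>
    h (measure_mono_null (Set.inter_subset_inter_left W hHsub) h0))⟩
  have hfin : Finite (X ⧸ H) := by
    have := Measure.finite_const_le_meas_of_disjoint_iUnion₀ μ
      (pos_iff_ne_zero.2 hV0) (As := fun q : X ⧸ H => τ (v * q.out⁻¹))
      (fun q => (hmeas _ (hpre V hV𝒵 _)).nullMeasurableSet) (fun q q' hqq' => ?_)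
      (measure_ne_top _ _)
    · rw [← Set.finite_univ_iff]
      convert this
      symm
      rw [Set.eq_univ_iff_forall]
      intro q
      exact (measure_preimage_mul μ _ V).ge
    · by_contra hne
      apply hqq'
      have h1 := hτeq _ _ hne
      rw [hττ, hττ] at h1
      rw [← Quotient.out_eq' q, ← Quotient.out_eq' q']
      refine QuotientGroup.eq.2 (hH.2 ?_)
      have h2 : ((q.out⁻¹ * q'.out) * ·) ⁻¹' τ v = (q'.out * ·) ⁻¹' ((q.out⁻¹ * ·) ⁻¹' τ v) := by
        ext x
        simp [mul_assoc]
      rw [h2, h1, hτ]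
  exact Subgroup.finiteIndex_of_finite_quotient

end Dichotomy

section ZeroLocus

variable {X K : Type*} [Field K]

/-- The common zero sets of the subsets of an algebra of functions. -/
def zeroLoci (A : Subalgebra K (X → K)) : Set (Set X) :=
  {V | ∃ s : Set (X → K), s ⊆ A ∧ V = {x | ∀ f ∈ s, f x = 0}}

theorem wellFoundedOn_zeroLoci (A : Subalgebra K (X → K)) [IsNoetherianRing A] :
    (zeroLoci A).WellFoundedOn (· < ·) := by
  let J : Set X → Ideal A := fun V =>
    { carrier := {f | ∀ x ∈ V, f.1 x = 0}
      add_mem' := fun {a b} ha hb x hx => by simp [ha x hx, hb x hx]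
      zero_mem' := fun x _ => rfl
      smul_mem' := fun c a ha x hx => by simp [ha x hx] }
  have hwf : WellFounded fun V W : Set X => J V > J W := InvImage.wf J wellFounded_gt
  refine Set.WellFoundedOn.mono' (fun V hV W _ hVW => ?_) hwf.wellFoundedOn
  refine lt_of_le_not_ge (fun f hf x hx => hf x (hVW.le hx)) fun hle => hVW.not_ge ?_
  obtain ⟨s, hs, rfl⟩ := hV
  exact fun x hx f hf => hle (x := ⟨f, hs hf⟩) (fun y hy => hy f hf) x hx

theorem univ_mem_zeroLoci (A : Subalgebra K (X → K)) : Set.univ ∈ zeroLoci A :=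
  ⟨∅, Set.empty_subset _, by simp⟩

theorem inter_mem_zeroLoci {A : Subalgebra K (X → K)} {V W : Set X} (hV : V ∈ zeroLoci A)
    (hW : W ∈ zeroLoci A) : V ∩ W ∈ zeroLoci A := by
  obtain ⟨s, hs, rfl⟩ := hV
  obtain ⟨t, ht, rfl⟩ := hW
  refine ⟨s ∪ t, Set.union_subset hs ht, ?_⟩
  ext x
  simp only [Set.mem_inter_iff, Set.mem_ofPred_eq, Set.mem_union, or_imp, forall_and]

theorem setOf_eq_zero_mem_zeroLoci {A : Subalgebra K (X → K)} {f : X → K} (hf : f ∈ A) :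
    {x | f x = 0} ∈ zeroLoci A :=
  ⟨{f}, by simpa using hf, by simp⟩

theorem preimage_mem_zeroLoci {A : Subalgebra K (X → K)} {τ : X → X}
    (hτ : ∀ f ∈ A, f ∘ τ ∈ A) {V : Set X} (hV : V ∈ zeroLoci A) : τ ⁻¹' V ∈ zeroLoci A := by
  obtain ⟨s, hs, rfl⟩ := hV
  refine ⟨(· ∘ τ) '' s, Set.image_subset_iff.2 fun f hf => hτ f (hs hf), ?_⟩
  ext x
  simp

theorem isClosed_of_mem_zeroLoci [TopologicalSpace X] [TopologicalSpace K] [T1Space K]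
    {A : Subalgebra K (X → K)} (hA : ∀ f ∈ A, Continuous f) {V : Set X}
    (hV : V ∈ zeroLoci A) : IsClosed V := by
  obtain ⟨s, hs, rfl⟩ := hV
  have : {x | ∀ f ∈ s, f x = 0} = ⋂ f ∈ s, f ⁻¹' {0} := by
    ext x
    simp
  rw [this]
  exact isClosed_biInter fun f hf => isClosed_singleton.preimage (hA f (hs hf))

theorem mul_entry_mem {ι : Type*} [Fintype ι] {A : Subalgebra K (X → K)} {θ η : X → Matrix ι ι K}
    (hθ : ∀ i j, (fun x => θ x i j) ∈ A) (hη : ∀ i j, (fun x => η x i j) ∈ A) (i j : ι) :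
    (fun x => (θ x * η x) i j) ∈ A := by
  have : (fun x => (θ x * η x) i j) = ∑ k, (fun x => θ x i k) * fun x => η x k j := by
    ext x
    simp [Matrix.mul_apply]
  rw [this]
  exact sum_mem fun k _ => mul_mem (hθ i k) (hη k j)

theorem const_entry_mem {ι : Type*} (A : Subalgebra K (X → K)) (M : Matrix ι ι K) (i j : ι) :
    (fun _ => M i j) ∈ A :=
  A.algebraMap_mem (M i j)

variable {ι T : Type*} [Fintype ι] [DecidableEq ι] [Group X]

/-- The algebra generated by the matrix entries of a family of representations and of their
inverses. -/
def entryAlgebra (σ : T → X →* Matrix ι ι K) : Subalgebra K (X → K) :=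
  Algebra.adjoin K (Set.range fun q : T × Bool × ι × ι =>
    fun x => σ q.1 (cond q.2.1 x x⁻¹) q.2.2.1 q.2.2.2)

variable {σ : T → X →* Matrix ι ι K}

theorem entry_mem_entryAlgebra (t : T) (b : Bool) (i j : ι) :
    (fun x => σ t (cond b x x⁻¹) i j) ∈ entryAlgebra σ :=
  Algebra.subset_adjoin ⟨(t, b, i, j), rfl⟩

instance [Finite T] : IsNoetherianRing (entryAlgebra σ) :=
  isNoetherianRing_of_fg (Subalgebra.fg_def.2 ⟨_, Set.finite_range _, rfl⟩)

theorem comp_mul_left_mem_entryAlgebra (g : X) {f : X → K} (hf : f ∈ entryAlgebra σ) :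
    f ∘ (g * ·) ∈ entryAlgebra σ := by
  induction hf using Algebra.adjoin_induction with
  | mem f hf =>
    obtain ⟨⟨t, b, i, j⟩, rfl⟩ := hf
    cases b
    · have := mul_entry_mem (entry_mem_entryAlgebra (σ := σ) t false)
        (const_entry_mem _ (σ t g⁻¹)) i j
      simpa [Function.comp_def] using this
    · have := mul_entry_mem (const_entry_mem _ (σ t g))
        (entry_mem_entryAlgebra (σ := σ) t true) i j
      simpa [Function.comp_def] using this
  | algebraMap r => exact (entryAlgebra σ).algebraMap_mem r
  | add f g _ _ hf hg => exact add_mem hf hg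
  | mul f g _ _ hf hg => exact mul_mem hf hg

theorem continuous_of_mem_entryAlgebra [TopologicalSpace X] [IsTopologicalGroup X]
    [TopologicalSpace K] [IsTopologicalRing K] (hσ : ∀ t, Continuous (σ t)) {f : X → K}
    (hf : f ∈ entryAlgebra σ) : Continuous f := by
  induction hf using Algebra.adjoin_induction with
  | mem f hf =>
    obtain ⟨⟨t, b, i, j⟩, rfl⟩ := hf
    cases b
    · exact ((hσ t).comp continuous_inv).matrix_elem i j
    · exact (hσ t).matrix_elem i j
  | algebraMap r => exact continuous_const
  | add f g _ _ hf hg => exact hf.add hg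
  | mul f g _ _ hf hg => exact hf.mul hg

/-- Some finite index subgroup of a compact linear group meets every Zariski closed set in a null
set or is contained in it. -/
theorem exists_finiteIndex_zeroLoci [TopologicalSpace X] [IsTopologicalGroup X]
    [MeasurableSpace X] [BorelSpace X] [TopologicalSpace K] [IsTopologicalRing K] [T1Space K]
    [Finite T] {μ : Measure X} [IsFiniteMeasure μ] [NeZero μ] [μ.IsMulLeftInvariant]
    (hσ : ∀ t, Continuous (σ t)) :
    ∃ H : Subgroup X, H.FiniteIndex ∧
      ∀ V ∈ zeroLoci (entryAlgebra σ), μ ((H : Set X) ∩ V) ≠ 0 → (H : Set X) ⊆ V :=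
  exists_finiteIndex_forall_subset (wellFoundedOn_zeroLoci _) (univ_mem_zeroLoci _)
    (fun _ hV _ hW => inter_mem_zeroLoci hV hW)
    (fun _ hV g => preimage_mem_zeroLoci (fun _ hf => comp_mul_left_mem_entryAlgebra g hf) hV)
    fun _ hV => (isClosed_of_mem_zeroLoci (fun _ hf => continuous_of_mem_entryAlgebra hσ hf)
      hV).measurableSet

end ZeroLocus

section WordMap

variable {K ι : Type*} [Field K] [Fintype ι] [DecidableEq ι]

theorem lift_entry_mem {G I : Type*} [Group G] (σ : G →* Matrix ι ι K) (w : FreeGroup I) (i j : ι) :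
    (fun g : I → G => σ (FreeGroup.lift g w) i j) ∈
      entryAlgebra fun t : I => σ.comp (Pi.evalMonoidHom (fun _ => G) t) := by
  induction w using FreeGroup.induction_on generalizing i j with
  | C1 => simpa using const_entry_mem _ (1 : Matrix ι ι K) i j
  | of t =>
    simpa using entry_mem_entryAlgebra (σ := fun t : I => σ.comp (Pi.evalMonoidHom (fun _ => G) t))
      t true i j
  | inv_of t _ =>
    simpa using entry_mem_entryAlgebra (σ := fun t : I => σ.comp (Pi.evalMonoidHom (fun _ => G) t))
      t false i j
  | mul u v hu hv => simpa using mul_entry_mem hu hv i j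

theorem setOf_lift_eq_one_mem_zeroLoci {G I : Type*} [Group G] {σ : G →* Matrix ι ι K}
    (hσ : Function.Injective σ) (w : FreeGroup I) :
    {g : I → G | FreeGroup.lift g w = 1} ∈
      zeroLoci (entryAlgebra fun t : I => σ.comp (Pi.evalMonoidHom (fun _ => G) t)) := by
  refine ⟨Set.range fun q : ι × ι => fun g : I → G =>
    σ (FreeGroup.lift g w) q.1 q.2 - (1 : Matrix ι ι K) q.1 q.2, ?_, ?_⟩
  · rintro _ ⟨q, rfl⟩
    exact sub_mem (lift_entry_mem σ w q.1 q.2) (const_entry_mem _ 1 q.1 q.2)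
  · ext g
    have h1 : FreeGroup.lift g w = 1 ↔ σ (FreeGroup.lift g w) = 1 := by
      rw [← map_one σ, hσ.eq_iff]
    simp only [Set.mem_ofPred_eq, Set.forall_mem_range, Prod.forall, sub_eq_zero, h1]
    exact Matrix.ext_iff.symm

theorem Subgroup.finiteIndex_comap {G G' : Type*} [Group G] [Group G'] (f : G →* G')
    (H : Subgroup G') [H.FiniteIndex] : (H.comap f).FiniteIndex :=
  by
  rw [Subgroup.finiteIndex_iff, Subgroup.index_comap]
  exact fun h => Subgroup.FiniteIndex.index_ne_zero (Subgroup.index_eq_zero_of_relIndex_eq_zero h)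

/-- If a word vanishes on a set of positive measure, then it vanishes identically on some coset of
a power of a finite index normal subgroup that is irreducible in measure. -/
theorem exists_normal_of_measure_ne_zero {G I : Type*} [Group G] [TopologicalSpace G]
    [IsTopologicalGroup G] [SecondCountableTopology G] [MeasurableSpace G] [BorelSpace G]
    [TopologicalSpace K] [IsTopologicalRing K] [T1Space K] [Fintype I] {μ : Measure G}
    [IsProbabilityMeasure μ] [μ.IsMulLeftInvariant] {σ : G →* Matrix ι ι K} (hσ : Continuous σ)
    (hinj : Function.Injective σ) {w : FreeGroup I}
    (hw : Measure.pi (fun _ : I => μ) {g : I → G | FreeGroup.lift g w = 1} ≠ 0) :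
    ∃ N : Subgroup G, N.Normal ∧ N.FiniteIndex ∧
      (∃ x : I → G, ∀ y : I → N, FreeGroup.lift (fun i => (y i : G) * x i) w = 1) ∧
      ∀ V ∈ zeroLoci (entryAlgebra fun _ : Unit => σ), μ ((N : Set G) ∩ V) ≠ 0 → (N : Set G) ⊆ V := by
  classical
  obtain ⟨H₁, hfin₁, hH₁⟩ := exists_finiteIndex_zeroLoci (σ := fun _ : Unit => σ) (μ := μ)
    fun _ => hσ
  obtain ⟨H, hfin, hH⟩ := exists_finiteIndex_zeroLoci
    (σ := fun t : I => σ.comp (Pi.evalMonoidHom (fun _ => G) t))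
    (μ := Measure.pi fun _ : I => μ) fun t => hσ.comp (continuous_apply t)
  obtain ⟨x, hx⟩ := exists_measure_inter_preimage_ne_zero (H := H) hw
  have hsub := hH _ (preimage_mem_zeroLoci (fun _ hf => comp_mul_left_mem_entryAlgebra x hf)
    (setOf_lift_eq_one_mem_zeroLoci hinj w)) hx
  let M : Subgroup G := H₁ ⊓ ⨅ i : I, H.comap (MonoidHom.mulSingle (fun _ => G) i)
  have hM : M.FiniteIndex := by
    have := Subgroup.finiteIndex_iInf fun i : I =>
      Subgroup.finiteIndex_comap (MonoidHom.mulSingle (fun _ => G) i) H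
    infer_instance
  refine ⟨M.normalCore, inferInstance, inferInstance, ⟨x, fun y => ?_⟩, fun V hV h => ?_⟩
  · have hmem : (fun i => (x i)⁻¹ * (y i : G) * x i) ∈ H := by
      refine Subgroup.pi_mem_of_mulSingle_mem _ fun i => ?_
      have h1 : (x i)⁻¹ * (y i : G) * x i ∈ M.normalCore := by
        simpa using (inferInstance : M.normalCore.Normal).conj_mem _ (y i).2 (x i)⁻¹
      exact (Subgroup.mem_iInf.1 (M.normalCore_le h1).2 i : _)
    have := hsub hmem
    simp only [Set.mem_preimage, Set.mem_ofPred_eq] at this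
    convert this using 3
    ext i
    simp [mul_assoc]
  · have hle : (M.normalCore : Set G) ⊆ H₁ := fun g hg => (M.normalCore_le hg).1
    exact hle.trans (hH₁ V hV fun h0 => h (measure_mono_null (Set.inter_subset_inter_left V hle) h0))

end WordMap

section Wedderburn

open scoped commutatorElement

/-- A group of units that commute modulo a nilpotent two-sided ideal is solvable. -/
theorem isSolvable_of_commute_mod_nilpotent {N A : Type*} [Group N] [Ring A] {J : Ideal A}
    [J.IsTwoSided] (hJ : IsNilpotent J) {f : N →* A} (hf : Function.Injective f)
    (hcomm : ∀ a b : A, a * b - b * a ∈ J) : Group.IsSolvable N := by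
  have hcom : ∀ (I : Ideal A) [I.IsTwoSided] (g h : N), f g * f h - f h * f g ∈ I →
      f ⁅g, h⁆ - 1 ∈ I := by
    intro I _ g h hI
    have h1 : f (h * g) * f (h * g)⁻¹ = 1 := by rw [← map_mul, mul_inv_cancel, map_one]
    have : f ⁅g, h⁆ - 1 = (f g * f h - f h * f g) * f (h * g)⁻¹ := by
      rw [sub_mul, ← map_mul f h g, h1, ← map_mul, ← map_mul, commutatorElement_def, mul_inv_rev]
      simp [mul_assoc]
    rw [this]
    exact I.mul_mem_right _ hI
  let U : ℕ → Subgroup N := fun k => ((Ideal.Quotient.mk (J ^ k)).toMonoidHom.comp f).ker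
  have hU : ∀ {k g}, g ∈ U k ↔ f g - 1 ∈ J ^ k := by
    intro k g
    rw [← Ideal.Quotient.eq, map_one]
    rfl
  have hder : ∀ k, derivedSeries N (k + 1) ≤ U (k + 1) := by
    intro k
    induction k with
    | zero =>
      rw [derivedSeries_succ, Subgroup.commutator_le]
      intro g _ h _
      rw [hU, zero_add, Submodule.pow_one]
      exact hcom J g h (hcomm _ _)
    | succ k ih =>
      rw [derivedSeries_succ, Subgroup.commutator_le]
      intro g hg h hh
      rw [hU]
      refine hcom _ g h ?_
      have hg' := hU.1 (ih hg)
      have hh' := hU.1 (ih hh)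
      have hle : J ^ (k + 1) * J ^ (k + 1) ≤ J ^ (k + 1 + 1) := by
        rw [Submodule.pow_succ (n := k + 1)]
        refine Ideal.mul_mono_right ((Ideal.pow_le_pow_right (by lia)).trans_eq
          (Submodule.pow_one J))
      have : f g * f h - f h * f g = (f g - 1) * (f h - 1) - (f h - 1) * (f g - 1) := by
        noncomm_ring
      rw [this]
      exact sub_mem (hle (Ideal.mul_mem_mul hg' hh')) (hle (Ideal.mul_mem_mul hh' hg'))
  obtain ⟨k, hk⟩ := hJ
  refine ⟨⟨k + 1, ?_⟩⟩
  rw [eq_bot_iff]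
  intro g hg
  have h1 : f g - 1 ∈ J ^ k := Ideal.pow_le_pow_right k.le_succ (hU.1 (hder k hg))
  rw [hk, Submodule.zero_eq_bot, Ideal.mem_bot, sub_eq_zero] at h1
  exact Subgroup.mem_bot.2 (hf (h1.trans (map_one f).symm))

/-- Over an algebraically closed field, a finite-dimensional algebra is commutative modulo its
radical or has a matrix algebra of size at least two as a quotient. -/
theorem commute_mod_jacobson_or_exists_surjective (K A : Type*) [Field K] [IsAlgClosed K] [Ring A]
    [Algebra K A] [FiniteDimensional K A] :
    (∀ a b : A, a * b - b * a ∈ Ring.jacobson A) ∨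
      ∃ (d : ℕ) (π : A →ₐ[K] Matrix (Fin d) (Fin d) K), 2 ≤ d ∧ Function.Surjective π := by
  have : IsArtinianRing A := IsArtinianRing.of_finite K A
  obtain ⟨m, d, _, ⟨e⟩⟩ :=
    IsSemisimpleRing.exists_algEquiv_pi_matrix_of_isAlgClosed K (A ⧸ Ring.jacobson A)
  by_cases hd : ∃ i, 2 ≤ d i
  · obtain ⟨i, hi⟩ := hd
    let q : A →ₐ[K] A ⧸ Ring.jacobson A := Ideal.Quotient.mkₐ K (Ring.jacobson A)
    have hq : Function.Surjective q := Ideal.Quotient.mkₐ_surjective K _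
    exact Or.inr ⟨d i, (Pi.evalAlgHom K _ i).comp (e.toAlgHom.comp q), hi,
      (Function.surjective_eval i).comp (e.surjective.comp hq)⟩
  · push Not at hd
    refine Or.inl fun a b => ?_
    rw [← Ideal.Quotient.eq]
    apply e.injective
    rw [map_mul, map_mul, map_mul, map_mul]
    ext i : 1
    have : Subsingleton (Fin (d i)) := Fin.subsingleton_iff_le_one.2 (by have := hd i; lia)
    ext j k
    simp only [Pi.mul_apply, Matrix.mul_apply]
    refine Finset.sum_congr rfl fun l _ => ?_
    rw [Subsingleton.elim l k, Subsingleton.elim j k, mul_comm]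

/-- A linear group over an algebraically closed field that is not solvable has an irreducible
subquotient representation of dimension at least two. -/
theorem isSolvable_or_exists_irreducible {N K ι : Type*} [Group N] [Field K] [IsAlgClosed K]
    [Fintype ι] [DecidableEq ι] {σ : N →* Matrix ι ι K} (hσ : Function.Injective σ) :
    Group.IsSolvable N ∨ ∃ (d : ℕ) (ρ : N →* Matrix (Fin d) (Fin d) K)
      (φ : Matrix ι ι K →ₗ[K] Matrix (Fin d) (Fin d) K), 2 ≤ d ∧
      Submodule.span K (Set.range ρ) = ⊤ ∧ ∀ x, ρ x = φ (σ x) := by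
  let A := Algebra.adjoin K (Set.range σ)
  let σA : N →* A := σ.codRestrict A fun x => Algebra.subset_adjoin ⟨x, rfl⟩
  have hspan : Submodule.span K (Set.range σA) = ⊤ := by
    refine Submodule.map_injective_of_injective (f := A.val.toLinearMap)
      Subtype.val_injective ?_
    rw [Submodule.map_span, Submodule.map_top, ← Set.range_comp]
    have h1 := Algebra.adjoin_eq_span K (Set.range σ)
    rw [← MonoidHom.coe_mrange, Submonoid.closure_eq, MonoidHom.coe_mrange] at h1
    change Submodule.span K (Set.range σ) = _
    rw [← h1]
    ext x
    simp [A]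
  rcases commute_mod_jacobson_or_exists_surjective K A with h | ⟨d, π, hd, hπ⟩
  · exact Or.inl (isSolvable_of_commute_mod_nilpotent
      (have := IsArtinianRing.of_finite K A; IsSemiprimaryRing.isNilpotent) (f := σA)
      (fun x y h => hσ (congrArg Subtype.val h)) h)
  · obtain ⟨φ, hφ⟩ := LinearMap.exists_extend (p := A.toSubmodule) π.toLinearMap
    refine Or.inr ⟨d, (π : A →* _).comp σA, φ, hd, ?_, fun x => ?_⟩
    · have := congrArg (Submodule.map π.toLinearMap) hspan
      rw [Submodule.map_span, Submodule.map_top, ← Set.range_comp,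
        LinearMap.range_eq_top.2 hπ] at this
      exact this
    · exact (LinearMap.congr_fun hφ (σA x)).symm

end Wedderburn

/-- A linear group over an algebraically closed field with an invariant probability measure is
virtually solvable or satisfies no nontrivial group law with positive probability. -/
theorem virtually_solvable_or_measure_eq_zero {G K ι : Type*} [Group G]
    [TopologicalSpace G] [IsTopologicalGroup G] [SecondCountableTopology G] [MeasurableSpace G]
    [BorelSpace G] [Field K] [IsAlgClosed K] [TopologicalSpace K] [IsTopologicalRing K] [T1Space K]
    [Fintype ι] [DecidableEq ι] {μ : Measure G} [IsProbabilityMeasure μ]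
    [μ.IsMulLeftInvariant] {σ : G →* Matrix ι ι K} (hσ : Continuous σ)
    (hinj : Function.Injective σ) :
    (∃ S : Subgroup G, S.FiniteIndex ∧ Group.IsSolvable S) ∨
      ∀ {I : Type} [Fintype I] (w : FreeGroup I), w ≠ 1 →
        Measure.pi (fun _ : I => μ) {g : I → G | FreeGroup.lift g w = 1} = 0 := by
  by_contra! h
  obtain ⟨hsolv, I, _, w, hw1, hw⟩ := h
  obtain ⟨N, _, hfin, ⟨x, hx⟩, hN⟩ := exists_normal_of_measure_ne_zero hσ hinj hw
  rcases isSolvable_or_exists_irreducible (σ := σ.comp N.subtype)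
    (hinj.comp Subtype.val_injective) with h | ⟨d, ρ, φ, hd, hspan, hρφ⟩
  · exact hsolv N hfin h
  obtain ⟨L, hL, hchain, hlaw⟩ := exists_twisted_law hw1 N x hx
  let res : (G → K) →ₐ[K] (N → K) := AlgHom.pi fun x : N => Pi.evalAlgHom K (fun _ : G => K) x
  let l : Filter N := Filter.comap Subtype.val (ae μ)
  have : l.NeBot := by
    rw [Filter.comap_neBot_iff]
    intro s hs
    by_contra! hempty
    obtain ⟨y, hy⟩ := exists_measure_inter_preimage_ne_zero (μ := μ) (H := N) (C := Set.univ)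
      (by simp)
    refine hy (measure_mono_null ?_ (mem_ae_iff.1 hs))
    exact fun g hg hgs => hempty ⟨g, hg.1⟩ hgs
  let R : Subalgebra K (N → K) := (entryAlgebra fun _ : Unit => σ).map res
  have hR : ∀ f ∈ R, f = 0 ∨ ∀ᶠ x in l, f x ≠ 0 := by
    rintro _ ⟨f, hf, rfl⟩
    by_cases h0 : μ ((N : Set G) ∩ {g | f g = 0}) = 0
    · refine Or.inr (Filter.mem_comap.2 ⟨_, compl_mem_ae_iff.2 h0, fun g hg hfg => ?_⟩)
      exact hg ⟨g.2, hfg⟩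
    · exact Or.inl (funext fun g => hN _ (setOf_eq_zero_mem_zeroLoci hf) h0 g.2)
  have hρR : ∀ γ b i j, (fun x : N => ρ ((MulAut.conjNormal γ : MulAut N)
      (cond b x x⁻¹)) i j) ∈ R := by
    intro γ b i j
    have := linearMap_comp_mem (R := R)
      (θ := fun g : N => σ (cond b (g : G) (g : G)⁻¹))
      (fun i j => ⟨_, entry_mem_entryAlgebra () b i j, rfl⟩)
      (Matrix.entryLinearMap K K i j ∘ₗ φ ∘ₗ LinearMap.mulLeft K (σ γ) ∘ₗ
        LinearMap.mulRight K (σ γ⁻¹))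
    convert this using 2 with g
    rw [hρφ]
    cases b <;> simp [mul_assoc]
  have h01 : (⟨0, zero_lt_two.trans_le hd⟩ : Fin d) ≠ ⟨1, hd⟩ := by simp
  obtain ⟨y, hy⟩ := exists_twisted_word_ne_one h01 hspan hR hρR L hL hchain
  exact hy (hlaw y)

theorem secondCountableTopology_of_isCompact {p n : ℕ} [Fact p.Prime]
    {G : Subgroup (GL (Fin n) ℚ_[p])} (hG : IsCompact (G : Set (GL (Fin n) ℚ_[p]))) :
    SecondCountableTopology G := by
  have : CompactSpace G := isCompact_iff_compactSpace.1 hG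
  have : SecondCountableTopology (Matrix (Fin n) (Fin n) ℚ_[p]) :=
    inferInstanceAs (SecondCountableTopology (Fin n → Fin n → ℚ_[p]))
  have hcont : Continuous fun g : G => (g.1 : Matrix (Fin n) (Fin n) ℚ_[p]) :=
    Units.continuous_val.comp continuous_subtype_val
  exact (hcont.isClosedEmbedding
    (Units.val_injective.comp Subtype.val_injective)).isEmbedding.secondCountableTopology

/-- (Probabilistic Tits alternative for compact linear groups over ℚ_p.)
A compact subgroup `G` of `GL_n(ℚ_p)`, with its normalized Haar probability measure `μ`,
is either virtually solvable or randomly free: for every `r ≥ 1` and every nontrivial word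
`w` in the free group on `r` generators, the solution set `X(G,w) ⊆ G^r` has measure zero
for the product measure. -/
theorem virtually_solvable_or_randomly_free_GL
    {p : ℕ} [Fact p.Prime] {n : ℕ} (hn : 1 ≤ n)
    (G : Subgroup (GL (Fin n) ℚ_[p])) (hG : IsCompact (G : Set (GL (Fin n) ℚ_[p])))
    [MeasurableSpace G] [BorelSpace G]
    (μ : Measure G) [μ.IsHaarMeasure] [IsProbabilityMeasure μ] :
    (∃ S : Subgroup G, S.FiniteIndex ∧ IsSolvable S) ∨
      (∀ (r : ℕ), 1 ≤ r → ∀ w : FreeGroup (Fin r), w ≠ 1 →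
        Measure.pi (fun _ : Fin r => μ) {g : Fin r → G | FreeGroup.lift g w = 1} = 0) := by
  have := secondCountableTopology_of_isCompact hG
  have hcont : Continuous (algebraMap ℚ_[p] (PadicAlgCl p)) := continuous_algebraMap _ _
  let σ : G →* Matrix (Fin n) (Fin n) (PadicAlgCl p) :=
    (algebraMap ℚ_[p] (PadicAlgCl p)).mapMatrix.toMonoidHom.comp
      ((Units.coeHom _).comp G.subtype)
  have hσ : Continuous σ :=
    (Units.continuous_val.comp continuous_subtype_val).matrix_map hcont
  have hinj : Function.Injective σ :=
    (Matrix.map_injective (algebraMap ℚ_[p] (PadicAlgCl p)).injective).comp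
      (Units.val_injective.comp Subtype.val_injective)
  exact (virtually_solvable_or_measure_eq_zero (μ := μ) hσ hinj).imp_right fun h r _ w => h w
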